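/- Let n ≥ 1 and k ≥ 0 be integers, m ∈ ℤ, s, λ ∈ ℂ, let h : ℝⁿ → ℂ be a nonzero harmonic polynomial homogeneous of degree k, and let ψ : (0,∞) → ℂ be twice continuously differentiable. Define F(θ,y) := e^{−imθ/2} ψ(‖y‖) h(y) for θ ∈ ℝ and y ∈ ℝⁿ, y ≠ 0. Then ‖y‖²( 4s (∂F/∂θ)(θ,y) + 4s²‖y‖² F(θ,y) + (Δ_y F)(θ,y) ) = 2λ F(θ,y) holds for all θ ∈ ℝ and all y ≠ 0 if and only if ρ²ψ''(ρ) + (n−1+2k)ρψ'(ρ) + (4s²ρ⁴ − 2ismρ² − 2λ)ψ(ρ) = 0 for all ρ > 0. -/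

import Mathlib

noncomputable section

/-- `n`-dimensional Euclidean space. -/
abbrev E (n : ℕ) := EuclideanSpace ℝ (Fin n)

/-- Partial derivative in the `j`-th coordinate direction. -/
noncomputable def pd {n : ℕ} (j : Fin n) (f : E n → ℂ) (y : E n) : ℂ :=
  fderiv ℝ f y (EuclideanSpace.single j 1)

/-- The Laplacian `Δ = ∑ⱼ ∂²/∂yⱼ²`. -/
noncomputable def lap {n : ℕ} (f : E n → ℂ) (y : E n) : ℂ :=
  ∑ j : Fin n, pd j (pd j f) y

/-- `h : ℝⁿ → ℂ` is a harmonic polynomial, homogeneous of degree `k`: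
it is given by a polynomial in the coordinates, `h (t • y) = t^k * h y`,
and `Δ h = 0`. -/
def IsHarmonicHomog {n : ℕ} (k : ℕ) (h : E n → ℂ) : Prop :=
  (∃ p : MvPolynomial (Fin n) ℂ, ∀ y : E n, h y = MvPolynomial.eval (fun j => ((y j : ℝ) : ℂ)) p) ∧
  (∀ (t : ℝ) (y : E n), h (t • y) = (t : ℂ) ^ k * h y) ∧
  (∀ y : E n, lap h y = 0)

/-- Leibniz rule for coordinate derivatives. -/
lemma pd_mul {n : ℕ} (j : Fin n) {f g : E n → ℂ} {y : E n}
    (hf : DifferentiableAt ℝ f y) (hg : DifferentiableAt ℝ g y) :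
    pd j (fun z => f z * g z) y = pd j f y * g y + f y * pd j g y := by
  unfold pd
  rw [fderiv_fun_mul hf hg]
  simp only [add_apply, smul_apply, smul_eq_mul]
  ring

lemma pd_add {n : ℕ} (j : Fin n) {f g : E n → ℂ} {y : E n}
    (hf : DifferentiableAt ℝ f y) (hg : DifferentiableAt ℝ g y) :
    pd j (fun z => f z + g z) y = pd j f y + pd j g y := by
  unfold pd
  rw [fderiv_fun_add hf hg, add_apply]

lemma hasFDerivAt_ofReal_coord {n : ℕ} (j : Fin n) (y : E n) :
    HasFDerivAt (fun z : E n => ((z j : ℝ) : ℂ))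
      (Complex.ofRealCLM.comp (EuclideanSpace.proj j : E n →L[ℝ] ℝ)) y :=
  (Complex.ofRealCLM.comp (EuclideanSpace.proj j : E n →L[ℝ] ℝ)).hasFDerivAt

lemma pd_coord {n : ℕ} (j : Fin n) (y : E n) :
    pd j (fun z : E n => ((z j : ℝ) : ℂ)) y = 1 := by
  unfold pd
  rw [(hasFDerivAt_ofReal_coord j y).fderiv]
  simp

lemma differentiableAt_radial {n : ℕ} {φ : ℝ → ℂ} {y : E n} (hy : y ≠ 0)
    (hφ : DifferentiableAt ℝ φ ‖y‖) : DifferentiableAt ℝ (fun z : E n => φ ‖z‖) y :=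
  hφ.comp y (differentiableAt_id.norm ℝ hy)

lemma fderiv_norm_apply {n : ℕ} {y : E n} (hy : y ≠ 0) (v : E n) :
    fderiv ℝ (fun z : E n => ‖z‖) y v = inner ℝ y v / ‖y‖ := by
  have hd : DifferentiableAt ℝ (fun z : E n => ‖z‖) y := differentiableAt_id.norm ℝ hy
  have hsq := (hd.hasFDerivAt.pow 2).unique (hasStrictFDerivAt_norm_sq y).hasFDerivAt
  have hv := congrArg (fun L : E n →L[ℝ] ℝ => L v) hsq
  have hr : ‖y‖ ≠ 0 := norm_ne_zero_iff.2 hy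
  simp at hv
  field_simp
  linarith

/-- Coordinate derivatives of a radial function. -/
lemma pd_radial {n : ℕ} (j : Fin n) {φ : ℝ → ℂ} {y : E n} (hy : y ≠ 0)
    (hφ : DifferentiableAt ℝ φ ‖y‖) :
    pd j (fun z : E n => φ ‖z‖) y = deriv φ ‖y‖ / (‖y‖ : ℂ) * (y j : ℂ) := by
  have hd : DifferentiableAt ℝ (fun z : E n => ‖z‖) y := differentiableAt_id.norm ℝ hy
  have hc := hφ.hasDerivAt.hasFDerivAt.comp y hd.hasFDerivAt
  have hc' : HasFDerivAt (fun z : E n => φ ‖z‖) _ y := hc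
  unfold pd
  rw [hc'.fderiv]
  simp only [ContinuousLinearMap.comp_apply, fderiv_norm_apply hy]
  simp [EuclideanSpace.inner_single_right]
  ring

lemma contDiff_eval_coord {n : ℕ} (p : MvPolynomial (Fin n) ℂ) :
    ContDiff ℝ 2 (fun y : E n => MvPolynomial.eval (fun j => ((y j : ℝ) : ℂ)) p) := by
  induction p using MvPolynomial.induction_on with
  | C a => simpa using contDiff_const
  | add p q hp hq => simpa using hp.add hq
  | mul_X p i hp =>
    simpa using hp.mul
      (Complex.ofRealCLM.comp (EuclideanSpace.proj i : E n →L[ℝ] ℝ)).contDiff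

/-- Euler's identity for homogeneous functions. -/
lemma sum_coord_mul_pd {n k : ℕ} {h : E n → ℂ} {y : E n}
    (hd : DifferentiableAt ℝ h y)
    (hk : ∀ (t : ℝ) (y : E n), h (t • y) = (t : ℂ) ^ k * h y) :
    ∑ j, (y j : ℂ) * pd j h y = k * h y := by
  have hsum : ∑ j, (y j : ℂ) * pd j h y = fderiv ℝ h y y := by
    have hy : ∑ j, y j • EuclideanSpace.single j (1 : ℝ) = y := by
      simpa using (EuclideanSpace.basisFun (Fin n) ℝ).sum_repr y
    conv_rhs => arg 2; rw [← hy]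
    simp [pd, map_sum]
  have hline : HasDerivAt (fun t : ℝ => t • y) y 1 := by
    simpa using (hasDerivAt_id (1 : ℝ)).smul_const y
  have h₁ : HasDerivAt (fun t : ℝ => h (t • y)) (fderiv ℝ h y y) 1 :=
    HasFDerivAt.comp_hasDerivAt_of_eq (1 : ℝ) hd.hasFDerivAt hline (by simp)
  have h₂ : HasDerivAt (fun t : ℝ => h (t • y)) (k * h y) 1 := by
    simp only [hk]
    simpa using ((Complex.ofRealCLM.hasDerivAt (x := (1 : ℝ))).pow k).mul_const (h y)
  rw [hsum, h₁.unique h₂]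

lemma sum_coord_sq {n : ℕ} (y : E n) : ∑ j, (y j : ℂ) ^ 2 = (‖y‖ : ℂ) ^ 2 := by
  rw [← Complex.ofReal_pow, EuclideanSpace.real_norm_sq_eq]
  push_cast
  rfl

lemma differentiableAt_pd {n : ℕ} (j : Fin n) {h : E n → ℂ} (hh : ContDiff ℝ 2 h) (y : E n) :
    DifferentiableAt ℝ (pd j h) y := by
  have hd : ContDiff ℝ 1 (fderiv ℝ h) := hh.fderiv_right (by norm_num)
  exact ((hd.differentiable (by norm_num)) y).clm_apply (differentiableAt_const _)

lemma differentiableAt_of_contDiffOn_Ioi {φ : ℝ → ℂ} (hφ : ContDiffOn ℝ 2 φ (Set.Ioi 0))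
    {r : ℝ} (hr : 0 < r) : DifferentiableAt ℝ φ r :=
  (hφ.contDiffAt (Ioi_mem_nhds hr)).differentiableAt (by norm_num)

lemma differentiableAt_deriv_of_contDiffOn_Ioi {φ : ℝ → ℂ}
    (hφ : ContDiffOn ℝ 2 φ (Set.Ioi 0)) {r : ℝ} (hr : 0 < r) :
    DifferentiableAt ℝ (deriv φ) r := by
  have hd : ContDiffOn ℝ 1 (deriv φ) (Set.Ioi 0) :=
    hφ.deriv_of_isOpen isOpen_Ioi (by norm_num)
  exact (hd.contDiffAt (Ioi_mem_nhds hr)).differentiableAt (by norm_num)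

/-- The Laplacian of a radial function times a homogeneous harmonic polynomial. -/
lemma norm_sq_mul_lap_radial_mul {n k : ℕ} {h : E n → ℂ} (hh : IsHarmonicHomog k h)
    {φ : ℝ → ℂ} (hφ : ContDiffOn ℝ 2 φ (Set.Ioi 0)) {y : E n} (hy : y ≠ 0) :
    (‖y‖ : ℂ) ^ 2 * lap (fun z : E n => φ ‖z‖ * h z) y =
      ((‖y‖ : ℂ) ^ 2 * deriv (deriv φ) ‖y‖
        + ((n : ℂ) - 1 + 2 * (k : ℂ)) * (‖y‖ : ℂ) * deriv φ ‖y‖) * h y := by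
  obtain ⟨⟨p, hp⟩, hk, hharm⟩ := hh
  have hC : ContDiff ℝ 2 h := by
    rw [funext hp]
    exact contDiff_eval_coord p
  have hdh : ∀ z, DifferentiableAt ℝ h z := hC.differentiable (by norm_num)
  have hr : 0 < ‖y‖ := norm_pos_iff.2 hy
  have hrC : (‖y‖ : ℂ) ≠ 0 := by exact_mod_cast hr.ne'
  have hdφ := differentiableAt_of_contDiffOn_Ioi hφ hr
  have hχ : HasDerivAt (fun r : ℝ => deriv φ r / (r : ℂ))
      ((deriv (deriv φ) ‖y‖ * ‖y‖ - deriv φ ‖y‖) / (‖y‖ : ℂ) ^ 2) ‖y‖ := by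
    simpa using (differentiableAt_deriv_of_contDiffOn_Ioi hφ hr).hasDerivAt.fun_div
      (Complex.ofRealCLM.hasDerivAt (x := ‖y‖)) hrC
  have hterm : ∀ j : Fin n, pd j (pd j (fun z : E n => φ ‖z‖ * h z)) y =
      ((deriv (deriv φ) ‖y‖ * ‖y‖ - deriv φ ‖y‖) / (‖y‖ : ℂ) ^ 3 * h y) * (y j : ℂ) ^ 2
        + deriv φ ‖y‖ / ‖y‖ * h y
        + 2 * (deriv φ ‖y‖ / ‖y‖) * ((y j : ℂ) * pd j h y) + φ ‖y‖ * pd j (pd j h) y := by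
    intro j
    have hev : pd j (fun z : E n => φ ‖z‖ * h z) =ᶠ[nhds y]
        fun z => (deriv φ ‖z‖ / (‖z‖ : ℂ) * (z j : ℂ)) * h z + φ ‖z‖ * pd j h z := by
      filter_upwards [isOpen_ne.mem_nhds hy] with z hz
      have hdz := differentiableAt_of_contDiffOn_Ioi hφ (norm_pos_iff.2 hz)
      rw [pd_mul j (differentiableAt_radial hz hdz) (hdh z), pd_radial j hz hdz]
    have hcoord := (hasFDerivAt_ofReal_coord j y).differentiableAt
    have hχy : DifferentiableAt ℝ (fun z : E n => deriv φ ‖z‖ / (‖z‖ : ℂ)) y :=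
      differentiableAt_radial (φ := fun r : ℝ => deriv φ r / (r : ℂ)) hy hχ.differentiableAt
    have hφy := differentiableAt_radial hy hdφ
    have hpd := differentiableAt_pd j hC y
    have hχpd := pd_radial j (φ := fun r : ℝ => deriv φ r / (r : ℂ)) hy hχ.differentiableAt
    rw [hχ.deriv] at hχpd
    have hcongr : pd j (pd j (fun z : E n => φ ‖z‖ * h z)) y = pd j
        (fun z => (deriv φ ‖z‖ / (‖z‖ : ℂ) * (z j : ℂ)) * h z + φ ‖z‖ * pd j h z) y := by
      rw [pd, hev.fderiv_eq, pd]
    rw [hcongr, pd_add j ((hχy.fun_mul hcoord).fun_mul (hdh y)) (hφy.fun_mul hpd),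
      pd_mul j (hχy.fun_mul hcoord) (hdh y), pd_mul j hχy hcoord, pd_mul j hφy hpd,
      pd_coord, pd_radial j hy hdφ, hχpd]
    field_simp
    ring
  have hl : ∑ j, pd j (pd j h) y = 0 := hharm y
  rw [lap, Finset.sum_congr rfl fun j _ => hterm j]
  simp only [Finset.sum_add_distrib, ← Finset.mul_sum, sum_coord_sq,
    sum_coord_mul_pd (hdh y) hk, hl, Finset.sum_const, Finset.card_univ, Fintype.card_fin,
    nsmul_eq_mul]
  field_simp
  ring

/-- A nonzero homogeneous function is nonzero somewhere on every sphere about the origin. -/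
lemma exists_norm_eq_ne_zero {n k : ℕ} (hn : 1 ≤ n) {h : E n → ℂ}
    (hk : ∀ (t : ℝ) (y : E n), h (t • y) = (t : ℂ) ^ k * h y) (hne : h ≠ 0)
    {ρ : ℝ} (hρ : 0 < ρ) : ∃ y : E n, ‖y‖ = ρ ∧ h y ≠ 0 := by
  obtain ⟨y, hy, hhy⟩ : ∃ y : E n, y ≠ 0 ∧ h y ≠ 0 := by
    obtain ⟨y, hhy⟩ := Function.ne_iff.1 hne
    rcases eq_or_ne y 0 with rfl | hy
    · refine ⟨EuclideanSpace.single ⟨0, hn⟩ 1, by simp, fun h₀ => hhy ?_⟩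
      have := hk 0 (EuclideanSpace.single ⟨0, hn⟩ 1)
      rw [h₀, zero_smul, mul_zero] at this
      exact this
    · exact ⟨y, hy, hhy⟩
  have hr : 0 < ‖y‖ := norm_pos_iff.2 hy
  have ht : 0 < ρ / ‖y‖ := div_pos hρ hr
  refine ⟨(ρ / ‖y‖) • y, ?_, ?_⟩
  · rw [norm_smul, Real.norm_of_nonneg ht.le, div_mul_cancel₀ _ hr.ne']
  · rw [hk]
    exact mul_ne_zero (pow_ne_zero _ (Complex.ofReal_ne_zero.2 ht.ne')) hhy

/-- With `F(θ,y) = e^{-imθ/2} ψ(‖y‖) h(y)` (`h ≠ 0` harmonic homogeneous of degree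
`k`, `ψ` C² on `(0,∞)`), the equation
`‖y‖²(4s ∂_θ F + 4s²‖y‖² F + Δ_y F) = 2λ F` holds for all `θ` and `y ≠ 0` iff
`ρ²ψ'' + (n-1+2k)ρψ' + (4s²ρ⁴ - 2ismρ² - 2λ)ψ = 0` for all `ρ > 0`. -/
theorem stmt8 (n k : ℕ) (hn : 1 ≤ n) (m : ℤ) (s lam : ℂ)
    (h : E n → ℂ) (hh : IsHarmonicHomog k h) (hne : h ≠ 0)
    (ψ : ℝ → ℂ) (hψ : ContDiffOn ℝ 2 ψ (Set.Ioi 0))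
    (F : ℝ → E n → ℂ)
    (hF : ∀ (θ : ℝ) (y : E n),
      F θ y = Complex.exp (-Complex.I * (m : ℂ) * (θ : ℂ) / 2) * ψ ‖y‖ * h y) :
    (∀ (θ : ℝ) (y : E n), y ≠ 0 →
        ((‖y‖ : ℝ) : ℂ) ^ 2 *
            (4 * s * deriv (fun θ' : ℝ => F θ' y) θ
              + 4 * s ^ 2 * ((‖y‖ : ℝ) : ℂ) ^ 2 * F θ y
              + lap (fun y' : E n => F θ y') y)
          = 2 * lam * F θ y) ↔
      (∀ ρ : ℝ, 0 < ρ →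
        ((ρ : ℝ) : ℂ) ^ 2 * deriv (deriv ψ) ρ
          + ((n : ℂ) - 1 + 2 * (k : ℂ)) * (ρ : ℂ) * deriv ψ ρ
          + (4 * s ^ 2 * ((ρ : ℝ) : ℂ) ^ 4 - 2 * Complex.I * s * (m : ℂ) * ((ρ : ℝ) : ℂ) ^ 2
              - 2 * lam) * ψ ρ = 0) := by
  have key : ∀ (θ : ℝ) (y : E n), y ≠ 0 →
      ((‖y‖ : ℝ) : ℂ) ^ 2 *
          (4 * s * deriv (fun θ' : ℝ => F θ' y) θ
            + 4 * s ^ 2 * ((‖y‖ : ℝ) : ℂ) ^ 2 * F θ y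
            + lap (fun y' : E n => F θ y') y) - 2 * lam * F θ y =
        Complex.exp (-Complex.I * (m : ℂ) * (θ : ℂ) / 2) * h y *
          ((‖y‖ : ℂ) ^ 2 * deriv (deriv ψ) ‖y‖
          + ((n : ℂ) - 1 + 2 * (k : ℂ)) * (‖y‖ : ℂ) * deriv ψ ‖y‖
          + (4 * s ^ 2 * (‖y‖ : ℂ) ^ 4 - 2 * Complex.I * s * (m : ℂ) * (‖y‖ : ℂ) ^ 2
              - 2 * lam) * ψ ‖y‖) := by
    intro θ y hy
    have hθ : deriv (fun θ' : ℝ => F θ' y) θ = -Complex.I * m / 2 * F θ y := by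
      have hlin : HasDerivAt (fun θ' : ℝ => -Complex.I * (m : ℂ) * (θ' : ℂ) / 2)
          (-Complex.I * m / 2) θ := by
        simpa using ((Complex.ofRealCLM.hasDerivAt (x := θ)).const_mul
          (-Complex.I * (m : ℂ))).div_const 2
      simp only [hF]
      rw [((hlin.cexp.mul_const (ψ ‖y‖)).mul_const (h y)).deriv]
      ring
    set c := Complex.exp (-Complex.I * (m : ℂ) * (θ : ℂ) / 2) with hc
    have hlap := norm_sq_mul_lap_radial_mul hh (φ := fun r => c * ψ r)
      (contDiffOn_const.mul hψ) hy
    have hd : deriv (fun r => c * ψ r) = fun r => c * deriv ψ r :=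
      funext fun r => deriv_const_mul_field c
    have hFθ : (fun y' : E n => F θ y') = fun z => c * ψ ‖z‖ * h z := funext (hF θ)
    simp only [hd, deriv_const_mul_field] at hlap
    rw [hθ, hFθ, mul_add, hlap, hF, ← hc]
    ring
  constructor
  · intro hpde ρ hρ
    obtain ⟨y, rfl, hhy⟩ := exists_norm_eq_ne_zero hn hh.2.1 hne hρ
    have hy : y ≠ 0 := norm_pos_iff.1 hρ
    have h₀ := key 0 y hy
    rw [hpde 0 y hy, sub_self] at h₀
    exact (mul_eq_zero.1 h₀.symm).resolve_left (mul_ne_zero (Complex.exp_ne_zero _) hhy)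
  · intro hode θ y hy
    rw [← sub_eq_zero, key θ y hy, hode ‖y‖ (norm_pos_iff.2 hy), mul_zero]

end
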